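/- For all 1 ≤ i, j ≤ n with i ≠ j and all m, p ∈ ℤ, [Σ_{k=1}^{i−1} (a_{k,i−1} a*_{ki})_m , Σ_{l=j+1}^{n} (a_{j+1,l} a*_{jl})_p] = 0 as linear operators on ℂ[x]. -/

import Mathlib

open MvPolynomial

/-- Index type for the variables `x_{ij,m}`, `1 ≤ i ≤ j ≤ n`, `m ∈ ℤ`
(only the indices with `i ≤ j` are ever used). -/
abbrev XIdx (n : ℕ) := Fin n × Fin n × ℤ

/-- The Fock space `ℂ[x]`. -/
abbrev Px (n : ℕ) := MvPolynomial (XIdx n) ℂ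

/-- The oscillator operator `a_{ij,m}` on `ℂ[x]`:  `∂/∂x_{ij,m}` if `m ≥ 0` and `j ≤ r`,
multiplication by `x_{ij,m}` otherwise. -/
noncomputable def aOp (n r : ℕ) (i j : Fin n) (m : ℤ) : Module.End ℂ (Px n) :=
  if 0 ≤ m ∧ (j : ℕ) + 1 ≤ r then (pderiv (i, j, m)).toLinearMap
  else LinearMap.mulLeft ℂ (X (i, j, m))

/-- The oscillator operator `a*_{ij,m}` on `ℂ[x]`:  multiplication by `x_{ij,-m}` if `m ≤ 0`
and `j ≤ r`, and `-∂/∂x_{ij,-m}` otherwise. -/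
noncomputable def aStar (n r : ℕ) (i j : Fin n) (m : ℤ) : Module.End ℂ (Px n) :=
  if m ≤ 0 ∧ (j : ℕ) + 1 ≤ r then LinearMap.mulLeft ℂ (X (i, j, -m))
  else - (pderiv (i, j, -m)).toLinearMap

/-- The quadratic operator `(a_{kl} a*_{k'l'})_m = Σ_{q∈ℤ} a_{kl,q} a*_{k'l',m-q}`
(pointwise `finsum`). -/
noncomputable def pairOp (n r : ℕ) (k l k' l' : Fin n) (m : ℤ) (P : Px n) : Px n :=
  ∑ᶠ q : ℤ, aOp n r k l q (aStar n r k' l' (m - q) P)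

/-- `Σ_{k=1}^{i-1} (a_{k,i-1} a*_{k,i})_m`. -/
noncomputable def sumLow (n r : ℕ) (i : Fin n) (m : ℤ) (P : Px n) : Px n :=
  ∑ k : Fin n, if h : k < i then
    pairOp n r k (⟨(i : ℕ) - 1, by have := i.isLt; omega⟩ : Fin n) k i m P
  else 0

/-- `Σ_{k=i+1}^{n} (a_{i+1,k} a*_{i,k})_m`. -/
noncomputable def sumHigh (n r : ℕ) (i : Fin n) (m : ℤ) (P : Px n) : Px n :=
  ∑ k : Fin n, if h : i < k then
    pairOp n r (⟨(i : ℕ) + 1, by have := k.isLt; have := Fin.lt_def.mp h; omega⟩ : Fin n)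
      k i k m P
  else 0

theorem MvPolynomial.pderiv_pderiv_comm {σ R : Type*} [CommRing R] (u v : σ)
    (P : MvPolynomial σ R) : pderiv u (pderiv v P) = pderiv v (pderiv u P) := by
  classical
  have h : ⁅pderiv (R := R) u, pderiv (R := R) v⁆ = 0 := by
    refine derivation_ext fun w => ?_
    simp [Derivation.commutator_apply, pderiv_X, Pi.single_apply, apply_ite]
  simpa [Derivation.commutator_apply, sub_eq_zero] using congrArg (fun D => D P) h

section Oscillators

variable {n : ℕ} (r : ℕ) (i j k l : Fin n)

/-- The canonical commutation relation between the oscillators `a` and `a*`. -/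
theorem aOp_mul_aStar (q s : ℤ) :
    aOp n r i j q * aStar n r k l s = aStar n r k l s * aOp n r i j q +
      if (i, j) = (k, l) ∧ q + s = 0 then 1 else 0 := by
  refine LinearMap.ext fun P => ?_
  by_cases h : (i, j) = (k, l) ∧ q + s = 0
  · obtain ⟨h1, h2⟩ := h
    obtain ⟨rfl, rfl⟩ := Prod.mk.inj h1
    obtain rfl : q = -s := by omega
    by_cases h3 : s ≤ 0 ∧ (j : ℕ) + 1 ≤ r
    · simp [aOp, aStar, h3]
    · have h4 : ¬ (0 ≤ -s ∧ (j : ℕ) + 1 ≤ r) := fun h => h3 ⟨by omega, h.2⟩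
      simp only [aOp, aStar, h3, h4]
      simp
  · have h5 : ((k, l, -s) : XIdx n) ≠ (i, j, q) := by
      intro h4
      simp only [Prod.mk.injEq] at h4
      exact h ⟨by simp [h4], by omega⟩
    rw [if_neg h]
    have hd := pderiv_pderiv_comm (R := ℂ) (i, j, q) (k, l, -s) P
    unfold aOp aStar
    split_ifs
    · simp [-Prod.mk.injEq, h5]
    · simpa using hd
    · simp [mul_left_comm]
    · simp [-Prod.mk.injEq, h5.symm]

theorem aOp_commute (q s : ℤ) : Commute (aOp n r i j q) (aOp n r k l s) := by
  refine LinearMap.ext fun P => ?_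
  have hd := pderiv_pderiv_comm (R := ℂ) (i, j, q) (k, l, s) P
  unfold aOp
  split_ifs with h1 h2 h2
  · simpa using hd
  · have h : ((k, l, s) : XIdx n) ≠ (i, j, q) := by
      rintro ⟨⟩
      exact h2 h1
    simp [-Prod.mk.injEq, h]
  · have h : ((i, j, q) : XIdx n) ≠ (k, l, s) := by
      rintro ⟨⟩
      exact h1 h2
    simp [-Prod.mk.injEq, h]
  · simp [mul_left_comm]

theorem aStar_commute (q s : ℤ) : Commute (aStar n r i j q) (aStar n r k l s) := by
  refine LinearMap.ext fun P => ?_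
  have hd := pderiv_pderiv_comm (R := ℂ) (i, j, -q) (k, l, -s) P
  unfold aStar
  split_ifs with h1 h2 h2
  · simp [mul_left_comm]
  · have h : ((i, j, -q) : XIdx n) ≠ (k, l, -s) := by
      simp only [ne_eq, Prod.mk.injEq, neg_inj]
      rintro ⟨rfl, rfl, rfl⟩
      exact h2 h1
    simp [-Prod.mk.injEq, h]
  · have h : ((k, l, -s) : XIdx n) ≠ (i, j, -q) := by
      simp only [ne_eq, Prod.mk.injEq, neg_inj]
      rintro ⟨rfl, rfl, rfl⟩
      exact h1 h2
    simp [-Prod.mk.injEq, h]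
  · simpa using hd

variable {j l}

/-- Only finitely many modes `a_{ij,q} a*_{kl,m-q}` act nontrivially on a given polynomial. -/
theorem finite_support_pairOp {i k : Fin n} (hjl : j ≤ l) (hne : (i, j) ≠ (k, l)) (m : ℤ)
    (P : Px n) :
    (Function.support fun q : ℤ => aOp n r i j q (aStar n r k l (m - q) P)).Finite := by
  have fin1 : {q : ℤ | ((i, j, q) : XIdx n) ∈ P.vars}.Finite :=
    P.vars.finite_toSet.preimage (f := fun q : ℤ => ((i, j, q) : XIdx n))
      fun a _ b _ h => by simpa using h
  have fin2 : {q : ℤ | ((k, l, -(m - q)) : XIdx n) ∈ P.vars}.Finite :=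
    P.vars.finite_toSet.preimage (f := fun q : ℤ => ((k, l, -(m - q)) : XIdx n))
      fun a _ b _ h => by simpa using h
  refine ((fin1.union fin2).union (Set.finite_Ico m 0)).subset fun q hq => ?_
  by_contra hout
  simp only [Set.mem_union, Set.mem_ofPred_eq, Set.mem_Ico, not_or] at hout
  obtain ⟨⟨h1, h2⟩, h3⟩ := hout
  apply hq
  by_cases hs : m - q ≤ 0 ∧ (l : ℕ) + 1 ≤ r
  · have ha : 0 ≤ q ∧ (j : ℕ) + 1 ≤ r := by
      have := Fin.le_def.mp hjl
      omega
    have hcomm := congrArg (fun T => T P) (aOp_mul_aStar r i j k l q (m - q))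
    simp only [hne, false_and, if_false, add_zero, Module.End.mul_apply] at hcomm
    have h0 : aOp n r i j q P = 0 := by
      simp [aOp, ha, pderiv_eq_zero_of_notMem_vars h1]
    simp only [hcomm, h0, map_zero]
  · have h0 : aStar n r k l (m - q) P = 0 := by
      simp only [aStar, if_neg hs, LinearMap.neg_apply]
      simp only [Derivation.coeFn_coe, pderiv_eq_zero_of_notMem_vars h2, neg_zero]
    simp only [h0, map_zero]

theorem pairOp_eq_sum {i k : Fin n} (hjl : j ≤ l) (hne : (i, j) ≠ (k, l)) (m : ℤ) (P : Px n) :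
    ∃ F : Finset ℤ, ∀ G, F ⊆ G →
      pairOp n r i j k l m P = ∑ q ∈ G, (aOp n r i j q * aStar n r k l (m - q)) P := by
  refine ⟨(finite_support_pairOp r hjl hne m P).toFinset, fun G hG => ?_⟩
  exact finsum_eq_sum_of_support_subset _ (by simpa using hG)

theorem pairOp_sum {ι : Type*} {i k : Fin n} (hjl : j ≤ l) (hne : (i, j) ≠ (k, l)) (m : ℤ)
    (s : Finset ι) (P : ι → Px n) :
    pairOp n r i j k l m (∑ x ∈ s, P x) = ∑ x ∈ s, pairOp n r i j k l m (P x) := by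
  unfold pairOp
  rw [← finsum_sum_comm _ _ fun x _ => finite_support_pairOp r hjl hne m (P x)]
  simp only [map_sum]

end Oscillators

/-- Wick's formula for the commutator of two quadratic elements in a Weyl-type algebra. -/
theorem mul_mul_sub_mul_mul_of_commute {A : Type*} [Ring A] {a b c d α γ : A}
    (hac : Commute a c) (hbd : Commute b d) (had : a * d = d * a + α) (hcb : c * b = b * c + γ)
    (hα : ∀ x, Commute α x) (hγ : ∀ x, Commute γ x) :
    a * b * (c * d) - c * d * (a * b) = α * (c * b) - γ * (a * d) := by
  have h1 : b * c = c * b - γ := by rw [hcb]; abel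
  have h2 : d * a = a * d - α := by rw [had]; abel
  calc a * b * (c * d) - c * d * (a * b) = a * (b * c) * d - c * (d * a) * b := by noncomm_ring
    _ = a * c * (b * d) - a * γ * d - c * a * (d * b) + c * α * b := by
        rw [h1, h2]; noncomm_ring
    _ = α * (c * b) - γ * (a * d) := by
        rw [hac.eq, hbd.eq, ← (hγ a).eq, ← (hα c).eq]; noncomm_ring

section Commutator

variable {n : ℕ} (r : ℕ)

theorem pairOp_mode_commutator (k l k' l' s t s' t' : Fin n) (m p q w : ℤ) :
    aOp n r k l q * aStar n r k' l' (m - q) * (aOp n r s t w * aStar n r s' t' (p - w)) -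
      aOp n r s t w * aStar n r s' t' (p - w) * (aOp n r k l q * aStar n r k' l' (m - q)) =
    (if (k, l) = (s', t') ∧ w = q + p then
      aOp n r s t w * aStar n r k' l' (m + p - w) else 0) -
    (if (s, t) = (k', l') ∧ w = q - m then
      aOp n r k l q * aStar n r s' t' (m + p - q) else 0) := by
  rw [mul_mul_sub_mul_mul_of_commute (aOp_commute r _ _ _ _ _ _) (aStar_commute r _ _ _ _ _ _)
    (aOp_mul_aStar r _ _ _ _ _ _) (aOp_mul_aStar r _ _ _ _ _ _)
    (fun x => by split_ifs; exacts [Commute.one_left x, Commute.zero_left x])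
    (fun x => by split_ifs; exacts [Commute.one_left x, Commute.zero_left x])]
  have e1 : q + (p - w) = 0 ↔ w = q + p := by omega
  have e2 : w + (m - q) = 0 ↔ w = q - m := by omega
  simp only [e1, e2, ite_mul, one_mul, zero_mul]
  congr 1
  · split_ifs with h
    · rw [h.2, show m + p - (q + p) = m - q by ring]
    · rfl
  · split_ifs with h
    · rw [h.2, show p - (q - m) = m + p - q by ring]
    · rfl

theorem pairOp_commutator {k l k' l' s t s' t' : Fin n} (hl : l ≤ l') (ht : t ≤ t')
    (hA : (k, l) ≠ (k', l')) (hB : (s, t) ≠ (s', t'))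
    (hAB : (k, l) = (s', t') → (s, t) ≠ (k', l')) (m p : ℤ) (P : Px n) :
    pairOp n r k l k' l' m (pairOp n r s t s' t' p P) -
      pairOp n r s t s' t' p (pairOp n r k l k' l' m P) =
    (if (k, l) = (s', t') then pairOp n r s t k' l' (m + p) P else 0) -
    (if (s, t) = (k', l') then pairOp n r k l s' t' (m + p) P else 0) := by
  obtain ⟨F₁, h₁⟩ := pairOp_eq_sum r hl hA m P
  obtain ⟨F₂, h₂⟩ := pairOp_eq_sum r hl hA m (pairOp n r s t s' t' p P)
  obtain ⟨F₃, h₃⟩ := pairOp_eq_sum r ht hB p P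
  obtain ⟨F₄, h₄⟩ := pairOp_eq_sum r ht hB p (pairOp n r k l k' l' m P)
  obtain ⟨F₅, h₅⟩ : ∃ F : Finset ℤ, ∀ G, F ⊆ G →
      (if (k, l) = (s', t') then pairOp n r s t k' l' (m + p) P else 0) =
      if (k, l) = (s', t') then
        ∑ q ∈ G, (aOp n r s t q * aStar n r k' l' (m + p - q)) P else 0 := by
    split_ifs with h
    · have := (Prod.mk.inj h).2
      exact pairOp_eq_sum r (ht.trans (this ▸ hl)) (hAB h) (m + p) P
    · exact ⟨∅, fun _ _ => rfl⟩
  obtain ⟨F₆, h₆⟩ : ∃ F : Finset ℤ, ∀ G, F ⊆ G →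
      (if (s, t) = (k', l') then pairOp n r k l s' t' (m + p) P else 0) =
      if (s, t) = (k', l') then
        ∑ q ∈ G, (aOp n r k l q * aStar n r s' t' (m + p - q)) P else 0 := by
    split_ifs with h
    · have := (Prod.mk.inj h).2
      exact pairOp_eq_sum r (hl.trans (this ▸ ht)) (fun h' => hAB h' h) (m + p) P
    · exact ⟨∅, fun _ _ => rfl⟩
  obtain ⟨F, hF⟩ : ∃ F, F = F₁ ∪ F₂ ∪ F₅.image (· - p) ∪ F₆ := ⟨_, rfl⟩
  obtain ⟨G, hG⟩ : ∃ G, G = F₃ ∪ F₄ ∪ F₅ ∪ F₆.image (· - m) := ⟨_, rfl⟩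
  rw [h₂ F (by grind), h₄ G (by grind), h₁ F (by grind), h₃ G (by grind),
    h₅ (G.filter fun w => w - p ∈ F) (by
      intro w hw
      simp only [hF, hG, Finset.mem_filter, Finset.mem_union, Finset.mem_image]
      exact ⟨by tauto, .inl (.inr ⟨w, hw, rfl⟩)⟩),
    h₆ (F.filter fun q => q - m ∈ G) (by
      intro w hw
      simp only [hF, hG, Finset.mem_filter, Finset.mem_union, Finset.mem_image]
      exact ⟨by tauto, .inr ⟨w, hw, rfl⟩⟩)]
  simp only [map_sum, ← Module.End.mul_apply]
  rw [Finset.sum_comm, ← Finset.sum_sub_distrib]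
  simp only [← Finset.sum_sub_distrib, ← LinearMap.sub_apply, pairOp_mode_commutator]
  simp only [LinearMap.sub_apply, Finset.sum_sub_distrib]
  congr 1
  · split_ifs with h
    · simp only [h, true_and, Finset.sum_filter]
      refine Finset.sum_congr rfl fun w _ => ?_
      simp only [← sub_eq_iff_eq_add, apply_ite (fun T : Module.End ℂ (Px n) => T P),
        LinearMap.zero_apply, Finset.sum_ite_eq]
    · simp [h]
  · rw [Finset.sum_comm]
    split_ifs with h
    · simp only [h, true_and, Finset.sum_filter]
      refine Finset.sum_congr rfl fun w _ => ?_
      simp only [apply_ite (fun T : Module.End ℂ (Px n) => T P),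
        LinearMap.zero_apply, Finset.sum_ite_eq']
    · simp [h]

end Commutator

theorem sumLow_eq {n : ℕ} (r : ℕ) {i i' : Fin n} (hi : (i' : ℕ) = i - 1) (m : ℤ) (P : Px n) :
    sumLow n r i m P = ∑ k ∈ Finset.univ.filter (· < i), pairOp n r k i' k i m P := by
  rw [sumLow, Finset.sum_filter]
  refine Finset.sum_congr rfl fun k _ => ?_
  split_ifs with h
  · congr 1
    exact Fin.ext hi.symm
  · rfl

theorem sumHigh_eq {n : ℕ} (r : ℕ) {j j' : Fin n} (hj : ∀ l, j < l → (j' : ℕ) = j + 1) (m : ℤ)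
    (P : Px n) :
    sumHigh n r j m P = ∑ l ∈ Finset.univ.filter (j < ·), pairOp n r j' l j l m P := by
  rw [sumHigh, Finset.sum_filter]
  refine Finset.sum_congr rfl fun l _ => ?_
  split_ifs with h
  · congr 1
    exact Fin.ext (hj l h).symm
  · rfl

/-- for `i ≠ j`,
`[Σ_{k=1}^{i−1} (a_{k,i−1} a*_{ki})_m , Σ_{l=j+1}^{n} (a_{j+1,l} a*_{jl})_p] = 0`. -/
theorem sumLow_sumHigh_commute (n r : ℕ) (hn : 1 ≤ n) (hr : r ≤ n)
    (i j : Fin n) (hij : i ≠ j) (m p : ℤ) (P : Px n) :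
    sumLow n r i m (sumHigh n r j p P) - sumHigh n r j p (sumLow n r i m P) = 0 := by
  obtain ⟨i', hi'⟩ : ∃ i' : Fin n, (i' : ℕ) = i - 1 := ⟨⟨i - 1, by omega⟩, rfl⟩
  obtain ⟨j', hj'⟩ : ∃ j' : Fin n, ∀ l, j < l → (j' : ℕ) = j + 1 := by
    refine ⟨⟨min (j + 1) (n - 1), by omega⟩, fun l hl => ?_⟩
    have := Fin.lt_def.mp hl
    simp only
    omega
  simp only [sumLow_eq r hi', sumHigh_eq r hj']
  have hA : ∀ k ∈ Finset.univ.filter (· < i), i' ≤ i ∧ (k, i') ≠ (k, i) := by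
    intro k hk
    have := Fin.lt_def.mp (Finset.mem_filter.mp hk).2
    simp only [ne_eq, Prod.mk.injEq, Fin.ext_iff, Fin.le_def]
    omega
  have hB : ∀ l ∈ Finset.univ.filter (j < ·), (j', l) ≠ (j, l) := by
    intro l hl
    have := hj' l (Finset.mem_filter.mp hl).2
    simp only [ne_eq, Prod.mk.injEq, Fin.ext_iff]
    omega
  have hL : ∀ k ∈ Finset.univ.filter (· < i), ∀ s (Q : Fin n → Px n),
      pairOp n r k i' k i m (∑ l ∈ s, Q l) = ∑ l ∈ s, pairOp n r k i' k i m (Q l) :=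
    fun k hk s Q => pairOp_sum r (hA k hk).1 (hA k hk).2 m s Q
  have hH : ∀ l ∈ Finset.univ.filter (j < ·), ∀ s (Q : Fin n → Px n),
      pairOp n r j' l j l p (∑ k ∈ s, Q k) = ∑ k ∈ s, pairOp n r j' l j l p (Q k) :=
    fun l hl s Q => pairOp_sum r le_rfl (hB l hl) p s Q
  rw [Finset.sum_congr rfl fun k hk => hL k hk _ _, Finset.sum_congr rfl fun l hl => hH l hl _ _,
    Finset.sum_comm, ← Finset.sum_sub_distrib]
  have key : ∀ l ∈ Finset.univ.filter (j < ·), ∀ k ∈ Finset.univ.filter (· < i),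
      pairOp n r k i' k i m (pairOp n r j' l j l p P) -
        pairOp n r j' l j l p (pairOp n r k i' k i m P) =
      (if k = j then if l = i' then pairOp n r j' i' j i (m + p) P else 0 else 0) -
      (if k = j' then if l = i then pairOp n r j' i' j i (m + p) P else 0 else 0) := by
    intro l hl k hk
    have hk' := Fin.lt_def.mp (Finset.mem_filter.mp hk).2
    have hl' := hj' l (Finset.mem_filter.mp hl).2
    rw [pairOp_commutator r (hA k hk).1 le_rfl (hA k hk).2 (hB l hl)]
    · simp only [Prod.mk.injEq, ite_and]
      grind
    · simp only [ne_eq, Prod.mk.injEq, Fin.ext_iff]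
      omega
  simp only [← Finset.sum_sub_distrib]
  rw [Finset.sum_congr rfl fun l hl => Finset.sum_congr rfl (key l hl)]
  simp only [Finset.sum_sub_distrib, Finset.sum_ite_eq', Finset.mem_filter, Finset.mem_univ,
    true_and]
  have swap : ∀ (c : Prop) [Decidable c] (x : Fin n),
      (∑ l ∈ Finset.univ.filter (j < ·), if c then
        if l = x then pairOp n r j' i' j i (m + p) P else 0 else 0) =
      if c ∧ j < x then pairOp n r j' i' j i (m + p) P else 0 := by
    intro c _ x
    by_cases hc : c <;> simp [hc]
  have hiff : j < i ∧ j < i' ↔ j' < i ∧ j < i := by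
    have := hj' i
    simp only [Fin.lt_def] at this ⊢
    omega
  simp only [swap, hiff, sub_self]
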